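/- There exist constants C > 0 and δ₀ > 0 such that for every 0 < δ ≤ δ₀ the following holds. Let D ⊂ ℝ² be a bounded open simply connected set and Ω ∈ ℝ, and assume the relative stream function Ψ(x) = (1/(2π)) ∫_D log|x − y| dy − Ω|x|²/2 takes a constant value on ∂D (i.e. D is a V-state with angular velocity Ω and rotation center the origin). If |Ω − 1/4| ≤ δ and |𝔻 Δ D| ≤ δ, then every boundary point of D lies in a thin annulus around the unit circle: for all x ∈ ∂D, 1 − C√δ ≤ |x| ≤ 1 + C√δ. -/

import Mathlib

open MeasureTheory Set

/-- The relative stream function of a patch `D` rotating with angular velocity `Ω`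
about the origin: `Ψ(x) = (1/(2π)) ∫_D log|x − y| dy − Ω|x|²/2`. -/
noncomputable def relStream (D : Set ℂ) (Ω : ℝ) (x : ℂ) : ℝ :=
  (1 / (2 * Real.pi)) * (∫ y in D, Real.log ‖x - y‖) - Ω * ‖x‖ ^ 2 / 2

/-- `D` is a V-state with angular velocity `Ω` and rotation center the origin:
the relative stream function is constant on the topological boundary of `D`. -/
def IsVState (D : Set ℂ) (Ω : ℝ) : Prop :=
  ∃ c : ℝ, ∀ x ∈ frontier D, relStream D Ω x = c

open Metric in
lemma integrableOn_inv_norm_ball (R : ℝ) :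
    IntegrableOn (fun y : ℂ => ‖y‖⁻¹) (ball 0 R) := by
  rw [integrableOn_fun_norm_addHaar volume (f := fun t : ℝ => t⁻¹)]
  have h : IntegrableOn (fun _ : ℝ => (1 : ℝ)) (Ioo 0 R) := by
    simp [integrableOn_const_iff]
  refine h.congr_fun (fun y hy => ?_) measurableSet_Ioo
  simp [Complex.finrank_real_complex, mul_inv_cancel₀ hy.1.ne']

open Metric in
lemma setIntegral_inv_norm_ball {R : ℝ} (hR : 0 ≤ R) :
    ∫ y in ball (0 : ℂ) R, ‖y‖⁻¹ = 2 * Real.pi * R := by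
  have h1 : ∫ y in ball (0 : ℂ) R, ‖y‖⁻¹ =
      ∫ y : ℂ, (Iio R).indicator (fun t : ℝ => t⁻¹) ‖y‖ := by
    rw [← integral_indicator measurableSet_ball]
    refine integral_congr_ae (.of_forall fun y => ?_)
    simp [indicator]
  have h2 : ∫ y in Ioi (0 : ℝ), y ^ (2 - 1) • (Iio R).indicator (fun t : ℝ => t⁻¹) y = R := by
    have : ∀ y ∈ Ioi (0 : ℝ), y ^ (2 - 1) • (Iio R).indicator (fun t : ℝ => t⁻¹) y =
        (Iio R).indicator (fun _ => (1 : ℝ)) y := by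
      intro y hy
      have : y ≠ 0 := ne_of_gt hy
      by_cases h : y < R <;> simp [h, this]
    rw [setIntegral_congr_fun measurableSet_Ioi this, setIntegral_indicator measurableSet_Iio]
    simp [Ioi_inter_Iio, hR]
  rw [h1, integral_fun_norm_addHaar, Complex.finrank_real_complex, h2, measureReal_def,
    Complex.volume_ball]
  simp
  ring

open Metric in
lemma preimage_sub_ball_zero (x : ℂ) (R : ℝ) : (fun y => x - y) ⁻¹' ball 0 R = ball x R := by
  ext y
  simp [dist_eq_norm, norm_sub_rev]

open Metric in
lemma integrableOn_inv_norm_sub_ball (x : ℂ) (R : ℝ) :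
    IntegrableOn (fun y : ℂ => ‖x - y‖⁻¹) (ball x R) := by
  rw [← preimage_sub_ball_zero]
  exact ((Measure.measurePreserving_sub_left volume x).integrableOn_comp_preimage
    (Homeomorph.subLeft x).measurableEmbedding).2 (integrableOn_inv_norm_ball R)

open Metric in
lemma setIntegral_inv_norm_sub_ball (x : ℂ) {R : ℝ} (hR : 0 ≤ R) :
    ∫ y in ball x R, ‖x - y‖⁻¹ = 2 * Real.pi * R := by
  rw [← preimage_sub_ball_zero, ← setIntegral_inv_norm_ball hR]
  exact (Measure.measurePreserving_sub_left volume x).setIntegral_preimage_emb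
    (Homeomorph.subLeft x).measurableEmbedding (fun y : ℂ => ‖y‖⁻¹) _

open Metric in
lemma inv_norm_sub_le_indicator_add {ρ : ℝ} (hρ : 0 < ρ) (x y : ℂ) :
    ‖x - y‖⁻¹ ≤ (ball x ρ).indicator (fun y => ‖x - y‖⁻¹) y + ρ⁻¹ := by
  by_cases h : y ∈ ball x ρ
  · simp [h, hρ.le]
  · simp only [h, not_false_eq_true, indicator_of_notMem, zero_add]
    simp only [mem_ball, not_lt, dist_eq_norm, norm_sub_rev y x] at h
    exact inv_anti₀ hρ h

open Metric in
lemma integrable_indicator_inv_norm_sub (x : ℂ) (ρ : ℝ) :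
    Integrable ((ball x ρ).indicator (fun y : ℂ => ‖x - y‖⁻¹)) :=
  (integrable_indicator_iff measurableSet_ball).2 (integrableOn_inv_norm_sub_ball x ρ)

lemma integrableOn_inv_norm_sub (x : ℂ) {E : Set ℂ} (hE : volume E ≠ ⊤) :
    IntegrableOn (fun y : ℂ => ‖x - y‖⁻¹) E := by
  refine Integrable.mono' (g := fun y => (Metric.ball x 1).indicator (fun y => ‖x - y‖⁻¹) y + 1⁻¹)
    ((integrable_indicator_inv_norm_sub x 1).integrableOn.add (integrableOn_const hE))
    (by fun_prop) (.of_forall fun y => ?_)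
  simpa using inv_norm_sub_le_indicator_add one_pos x y

open Metric in
lemma setIntegral_inv_norm_sub_le (x : ℂ) {E : Set ℂ} (hE : volume E ≠ ⊤)
    {δ : ℝ} (hδ : 0 < δ) (h : volume.real E ≤ δ) :
    ∫ y in E, ‖x - y‖⁻¹ ≤ (2 * Real.pi + 1) * √δ := by
  have hρ : 0 < √δ := Real.sqrt_pos.2 hδ
  have hi := integrable_indicator_inv_norm_sub x √δ
  calc ∫ y in E, ‖x - y‖⁻¹
      ≤ ∫ y in E, ((ball x √δ).indicator (fun y => ‖x - y‖⁻¹) y + (√δ)⁻¹) :=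
        integral_mono (integrableOn_inv_norm_sub x hE)
          (hi.integrableOn.add (integrableOn_const hE))
          (fun y => inv_norm_sub_le_indicator_add hρ x y)
    _ = (∫ y in E, (ball x √δ).indicator (fun y => ‖x - y‖⁻¹) y) + volume.real E * (√δ)⁻¹ := by
        rw [integral_add hi.integrableOn (integrableOn_const hE)]
        simp
    _ ≤ 2 * Real.pi * √δ + δ * (√δ)⁻¹ := by
        gcongr
        rw [← setIntegral_inv_norm_sub_ball x hρ.le, ← integral_indicator measurableSet_ball]
        refine setIntegral_le_integral hi
          (.of_forall fun y => indicator_nonneg (fun _ _ => by positivity) _)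
    _ = (2 * Real.pi + 1) * √δ := by
        have : δ * (√δ)⁻¹ = √δ := by rw [← div_eq_mul_inv, Real.div_sqrt]
        rw [this]; ring

lemma abs_log_le_add_inv {t : ℝ} (ht : 0 ≤ t) : |Real.log t| ≤ t + t⁻¹ := by
  rcases ht.eq_or_lt with rfl | ht
  · simp
  have h1 := Real.log_le_sub_one_of_pos ht
  have h2 := Real.one_sub_inv_le_log_of_pos ht
  have : 0 < t⁻¹ := by positivity
  rw [abs_le]
  constructor <;> linarith

lemma integrableOn_log_norm_sub (x : ℂ) {S : Set ℂ} (hS : Bornology.IsBounded S)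
    (hm : MeasurableSet S) : IntegrableOn (fun y : ℂ => Real.log ‖x - y‖) S := by
  obtain ⟨R, hR⟩ := hS.subset_closedBall x
  have hfin : volume S ≠ ⊤ := hS.measure_lt_top.ne
  refine Integrable.mono' (g := fun y => R + ‖x - y‖⁻¹)
    ((integrableOn_const hfin).add (integrableOn_inv_norm_sub x hfin)) ?_ ?_
  · exact (Real.measurable_log.comp (by fun_prop)).aestronglyMeasurable
  · filter_upwards [ae_restrict_mem hm] with y hy
    refine (abs_log_le_add_inv (norm_nonneg _)).trans ?_
    have := hR hy
    rw [Metric.mem_closedBall, dist_eq_norm, norm_sub_rev] at this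
    gcongr

lemma log_div_le {a b d : ℝ} (ha : 0 < a) (hb : 0 < b) (h : a ≤ b + d) :
    Real.log a - Real.log b ≤ d * b⁻¹ := by
  rw [← Real.log_div ha.ne' hb.ne']
  refine (Real.log_le_sub_one_of_pos (by positivity)).trans ?_
  rw [← div_eq_mul_inv, sub_le_iff_le_add, div_add_one hb.ne']
  gcongr
  linarith

lemma abs_log_norm_sub_sub_le {x z y : ℂ} (hx : y ≠ x) (hz : y ≠ z) :
    |Real.log ‖x - y‖ - Real.log ‖z - y‖| ≤ ‖x - z‖ * (‖x - y‖⁻¹ + ‖z - y‖⁻¹) := by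
  have ha : 0 < ‖x - y‖ := norm_pos_iff.2 (sub_ne_zero.2 hx.symm)
  have hb : 0 < ‖z - y‖ := norm_pos_iff.2 (sub_ne_zero.2 hz.symm)
  have h1 : ‖x - y‖ ≤ ‖z - y‖ + ‖x - z‖ := by
    linarith [norm_sub_le_norm_sub_add_norm_sub x z y]
  have h2 : ‖z - y‖ ≤ ‖x - y‖ + ‖x - z‖ := by
    linarith [norm_sub_le_norm_sub_add_norm_sub z x y, norm_sub_rev x z]
  have := log_div_le ha hb h1
  have := log_div_le hb ha h2
  have : 0 ≤ ‖x - z‖ * ‖x - y‖⁻¹ := by positivity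
  have : 0 ≤ ‖x - z‖ * ‖z - y‖⁻¹ := by positivity
  rw [mul_add, abs_le]
  constructor <;> linarith

lemma abs_setIntegral_log_norm_sub_sub_le (x z : ℂ) {E : Set ℂ} (hE : volume E ≠ ⊤)
    {δ : ℝ} (hδ : 0 < δ) (h : volume.real E ≤ δ) :
    |∫ y in E, (Real.log ‖x - y‖ - Real.log ‖z - y‖)| ≤
      ‖x - z‖ * (2 * ((2 * Real.pi + 1) * √δ)) := by
  have hx := integrableOn_inv_norm_sub x hE
  have hz := integrableOn_inv_norm_sub z hE
  calc |∫ y in E, (Real.log ‖x - y‖ - Real.log ‖z - y‖)|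
      ≤ ∫ y in E, ‖x - z‖ * (‖x - y‖⁻¹ + ‖z - y‖⁻¹) := by
        rw [← Real.norm_eq_abs]
        refine norm_integral_le_of_norm_le ((hx.add hz).const_mul _) (ae_restrict_of_ae ?_)
        filter_upwards [Measure.ae_ne volume x, Measure.ae_ne volume z] with y h1 h2
        exact abs_log_norm_sub_sub_le h1 h2
    _ = ‖x - z‖ * ((∫ y in E, ‖x - y‖⁻¹) + ∫ y in E, ‖z - y‖⁻¹) := by
        rw [integral_const_mul, integral_add hx hz]
    _ ≤ ‖x - z‖ * (2 * ((2 * Real.pi + 1) * √δ)) := by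
        gcongr
        linarith [setIntegral_inv_norm_sub_le x hE hδ h, setIntegral_inv_norm_sub_le z hE hδ h]

/-- Integration over the plane as a radial integral of circle averages. -/
lemma integral_eq_integral_circleAverage {g : ℂ → ℝ} (hg : Integrable g) :
    ∫ y, g y = ∫ r in Ioi (0 : ℝ), r * (2 * Real.pi * Real.circleAverage g 0 r) := by
  have hint : IntegrableOn (fun p : ℝ × ℝ => p.1 • g (Complex.polarCoord.symm p))
      (Ioi (0 : ℝ) ×ˢ Ioo (-Real.pi) Real.pi) := by
    have h1 : Integrable (fun p : ℝ × ℝ => g (Complex.measurableEquivRealProd.symm p)) :=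
      (Complex.volume_preserving_equiv_real_prod.symm.integrable_comp_emb
        Complex.measurableEquivRealProd.symm.measurableEmbedding).2 hg
    have h2 := (integrableOn_image_iff_integrableOn_abs_det_fderiv_smul volume
      polarCoord.open_target.measurableSet
      (fun p _ => (hasFDerivAt_polarCoord_symm p).hasFDerivWithinAt)
      polarCoord.symm.injOn _).1 (h1.integrableOn (s := polarCoord.symm '' polarCoord.target))
    refine h2.congr_fun (fun p hp => ?_) polarCoord.open_target.measurableSet
    simp only [det_fderivPolarCoordSymm, abs_of_pos (show 0 < p.1 from hp.1)]
    rw [Complex.measurableEquivRealProd_symm_polarCoord_symm_apply]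
  rw [← Complex.integral_comp_polarCoord_symm, polarCoord_target, Measure.volume_eq_prod,
    setIntegral_prod _ hint]
  refine setIntegral_congr_fun measurableSet_Ioi fun r _ => ?_
  have hper : Function.Periodic (fun θ => g (circleMap 0 r θ)) (2 * Real.pi) := fun θ => by
    simp [periodic_circleMap 0 r θ]
  have h3 := hper.intervalIntegral_add_eq (-Real.pi) 0
  rw [show -Real.pi + 2 * Real.pi = Real.pi by ring, zero_add] at h3
  have h4 : ∫ θ in Ioo (-Real.pi) Real.pi, g (Complex.polarCoord.symm (r, θ)) =
      ∫ θ in (0 : ℝ)..2 * Real.pi, g (circleMap 0 r θ) := by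
    rw [← h3, intervalIntegral.integral_of_le (by linarith [Real.pi_pos]),
      integral_Ioc_eq_integral_Ioo]
    refine setIntegral_congr_fun measurableSet_Ioo fun θ _ => ?_
    simp [circleMap, Complex.exp_mul_I]
  simp only [integral_const_mul, smul_eq_mul, h4, Real.circleAverage_def]
  field_simp

lemma setIntegral_unitBall_log_norm_sub (x : ℂ) :
    ∫ y in Metric.ball (0 : ℂ) 1, Real.log ‖x - y‖ =
      2 * Real.pi * ∫ r in (0 : ℝ)..1, r * (Real.log r + Real.posLog (r⁻¹ * ‖x‖)) := by
  have hint := integrableOn_log_norm_sub x Metric.isBounded_ball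
    (measurableSet_ball (x := (0 : ℂ)) (ε := 1))
  rw [← integral_indicator measurableSet_ball, integral_eq_integral_circleAverage
    ((integrable_indicator_iff measurableSet_ball).2 hint),
    intervalIntegral.integral_of_le zero_le_one, integral_Ioc_eq_integral_Ioo,
    ← integral_const_mul, ← Ioi_inter_Iio, ← setIntegral_indicator measurableSet_Iio]
  refine setIntegral_congr_fun measurableSet_Ioi fun r (hr : 0 < r) => ?_
  by_cases h : r < 1
  · have : Real.circleAverage ((Metric.ball (0 : ℂ) 1).indicator fun y => Real.log ‖x - y‖) 0 r =
        Real.circleAverage (fun y => Real.log ‖y - x‖) 0 r := by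
      refine Real.circleAverage_congr_sphere fun y hy => ?_
      have hy' : y ∈ Metric.ball (0 : ℂ) 1 := by
        simp only [mem_sphere_iff_norm, sub_zero, abs_of_pos hr] at hy
        simpa [hy] using h
      simp [hy', norm_sub_rev]
    simp only [this, circleAverage_log_norm_sub_const_eq_log_radius_add_posLog hr.ne', zero_sub,
      norm_neg, mem_Iio, h, indicator_of_mem]
    ring
  · have : Real.circleAverage ((Metric.ball (0 : ℂ) 1).indicator fun y => Real.log ‖x - y‖) 0 r =
        Real.circleAverage (fun _ => (0 : ℝ)) 0 r := by
      refine Real.circleAverage_congr_sphere fun y hy => ?_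
      simp only [mem_sphere_iff_norm, sub_zero, abs_of_pos hr] at hy
      simp [hy, h]
    simp [this, h, Real.circleAverage_const]

lemma mul_log_add_posLog_of_le {r a : ℝ} (hr : 0 < r) (h : r ≤ a) :
    r * (Real.log r + Real.posLog (r⁻¹ * a)) = r * Real.log a := by
  have ha : 0 < a := hr.trans_le h
  rw [Real.posLog_eq_log, Real.log_mul (by positivity) ha.ne', Real.log_inv]
  · ring
  · rw [abs_of_nonneg (by positivity), ← div_eq_inv_mul]
    exact (one_le_div hr).2 h

lemma mul_log_add_posLog_of_ge {r a : ℝ} (hr : 0 < r) (ha : 0 ≤ a) (h : a ≤ r) :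
    r * (Real.log r + Real.posLog (r⁻¹ * a)) = r * Real.log r := by
  rw [(Real.posLog_eq_zero_iff _).2, add_zero]
  rw [abs_of_nonneg (by positivity), ← div_eq_inv_mul]
  exact (div_le_one hr).2 h

lemma intervalIntegral_mul_log {a : ℝ} (ha : 0 ≤ a) (h1 : a ≤ 1) :
    ∫ r in a..1, r * Real.log r = (a ^ 2 - 1) / 4 - a ^ 2 * Real.log a / 2 := by
  have := intervalIntegral.integral_eq_sub_of_hasDerivAt_of_le h1
    (f := fun r => r * (r * Real.log r) / 2 - r ^ 2 / 4) (f' := fun r => r * Real.log r)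
    (((continuous_id.mul Real.continuous_mul_log).div_const 2).sub (by fun_prop)).continuousOn
    (fun r hr => by
      have hr0 : r ≠ 0 := (ha.trans_lt hr.1).ne'
      have h := ((((hasDerivAt_id r).mul ((hasDerivAt_id r).mul (Real.hasDerivAt_log hr0))).div_const
        2).sub ((hasDerivAt_pow 2 r).div_const 4))
      convert! h using 1
      simp only [Pi.mul_apply, id]
      field_simp
      push_cast
      ring)
    (Real.continuous_mul_log.intervalIntegrable _ _)
  rw [this]
  simp
  ring

lemma setIntegral_unitBall_log_norm_sub_of_one_le {x : ℂ} (hx : 1 ≤ ‖x‖) :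
    ∫ y in Metric.ball (0 : ℂ) 1, Real.log ‖x - y‖ = Real.pi * Real.log ‖x‖ := by
  have : ∫ r in (0 : ℝ)..1, r * (Real.log r + Real.posLog (r⁻¹ * ‖x‖)) =
      ∫ r in (0 : ℝ)..1, r * Real.log ‖x‖ := by
    refine intervalIntegral.integral_congr_ae (.of_forall fun r hr => ?_)
    rw [uIoc_of_le zero_le_one] at hr
    exact mul_log_add_posLog_of_le hr.1 (hr.2.trans hx)
  rw [setIntegral_unitBall_log_norm_sub, this, intervalIntegral.integral_mul_const, integral_id]
  ring

lemma setIntegral_unitBall_log_norm_sub_of_le_one {x : ℂ} (hx : ‖x‖ ≤ 1) :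
    ∫ y in Metric.ball (0 : ℂ) 1, Real.log ‖x - y‖ = Real.pi * (‖x‖ ^ 2 - 1) / 2 := by
  have h0 := norm_nonneg x
  have e1 : EqOn (fun r => r * Real.log ‖x‖)
      (fun r => r * (Real.log r + Real.posLog (r⁻¹ * ‖x‖))) (uIoc 0 ‖x‖) := fun r hr => by
    rw [uIoc_of_le h0] at hr
    exact (mul_log_add_posLog_of_le hr.1 hr.2).symm
  have e2 : EqOn (fun r => r * Real.log r)
      (fun r => r * (Real.log r + Real.posLog (r⁻¹ * ‖x‖))) (uIoc ‖x‖ 1) := fun r hr => by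
    rw [uIoc_of_le hx] at hr
    exact (mul_log_add_posLog_of_ge (h0.trans_lt hr.1) h0 hr.1.le).symm
  have i1 : IntervalIntegrable (fun r => r * Real.log ‖x‖) volume 0 ‖x‖ :=
    (continuous_id.mul continuous_const).intervalIntegrable _ _
  have i2 : IntervalIntegrable (fun r => r * Real.log r) volume ‖x‖ 1 :=
    Real.continuous_mul_log.intervalIntegrable _ _
  rw [setIntegral_unitBall_log_norm_sub,
    ← intervalIntegral.integral_add_adjacent_intervals (i1.congr e1) (i2.congr e2),
    ← intervalIntegral.integral_congr_ae (.of_forall e1),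
    ← intervalIntegral.integral_congr_ae (.of_forall e2),
    intervalIntegral.integral_mul_const, integral_id, intervalIntegral_mul_log h0 hx]
  ring

lemma relStream_unitBall_of_le_one {x : ℂ} (hx : ‖x‖ ≤ 1) :
    relStream (Metric.ball 0 1) (1 / 4) x + 1 / 8 = (‖x‖ ^ 2 - 1) / 8 := by
  rw [relStream, setIntegral_unitBall_log_norm_sub_of_le_one hx]
  field_simp
  ring

lemma relStream_unitBall_of_one_le {x : ℂ} (hx : 1 ≤ ‖x‖) :
    relStream (Metric.ball 0 1) (1 / 4) x + 1 / 8 = Real.log ‖x‖ / 2 - (‖x‖ ^ 2 - 1) / 8 := by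
  rw [relStream, setIntegral_unitBall_log_norm_sub_of_one_le hx]
  field_simp
  ring

lemma abs_norm_sub_one_le_relStream_unitBall {x : ℂ} (hx : ‖x‖ ≤ 6 / 5) :
    |‖x‖ - 1| ≤ 10 * |relStream (Metric.ball 0 1) (1 / 4) x + 1 / 8| := by
  have h0 := norm_nonneg x
  rcases le_total ‖x‖ 1 with h | h
  · rw [relStream_unitBall_of_le_one h, abs_of_nonpos (by linarith), abs_of_nonpos (by nlinarith)]
    nlinarith
  · rw [relStream_unitBall_of_one_le h, abs_of_nonneg (by linarith)]
    refine le_trans ?_ (mul_le_mul_of_nonneg_left (le_abs_self _) (by norm_num))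
    have h1 := Real.one_sub_inv_le_log_of_pos (show 0 < ‖x‖ by linarith)
    have h2 : 1 - ‖x‖⁻¹ ≥ (‖x‖ - 1) * (5 / 6) := by
      have : ‖x‖⁻¹ * ‖x‖ = 1 := inv_mul_cancel₀ (by linarith)
      have h3 : 5 / 6 ≤ ‖x‖⁻¹ := by
        rw [le_inv_comm₀ (by norm_num) (by linarith)]
        linarith
      nlinarith
    nlinarith

lemma relStream_unitBall_le_abs_norm_sub_one {x : ℂ} (hx : ‖x‖ ≤ 6 / 5) :
    |relStream (Metric.ball 0 1) (1 / 4) x + 1 / 8| ≤ |‖x‖ - 1| / 2 := by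
  have h0 := norm_nonneg x
  rcases le_total ‖x‖ 1 with h | h
  · rw [relStream_unitBall_of_le_one h, abs_of_nonpos (by nlinarith), abs_of_nonpos (by linarith)]
    nlinarith
  · rw [relStream_unitBall_of_one_le h, abs_of_nonneg (show 0 ≤ ‖x‖ - 1 by linarith), abs_le]
    have h1 := Real.log_le_sub_one_of_pos (show 0 < ‖x‖ by linarith)
    have h2 := Real.log_nonneg h
    constructor <;> nlinarith

lemma setIntegral_sub_setIntegral_eq {A B : Set ℂ} {f : ℂ → ℝ} (hA : MeasurableSet A)
    (hB : MeasurableSet B) (hfA : IntegrableOn f A) (hfB : IntegrableOn f B) :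
    (∫ y in B, f y) - ∫ y in A, f y = (∫ y in B \ A, f y) - ∫ y in A \ B, f y := by
  rw [← integral_inter_add_sdiff hB hfA, ← integral_inter_add_sdiff hA hfB, inter_comm]
  ring

lemma abs_relStream_unitBall_sub_le {D : Set ℂ} {Ω δ : ℝ} (hb : Bornology.IsBounded D)
    (ho : IsOpen D) (hδ : 0 < δ) (hδ1 : δ ≤ 1) (hΩ : |Ω - 1 / 4| ≤ δ)
    (hvol : volume.real (symmDiff (Metric.ball (0 : ℂ) 1) D) ≤ δ) {x z : ℂ}
    (hx : ‖x‖ ≤ 2) (hz : ‖z‖ ≤ 2) (heq : relStream D Ω x = relStream D Ω z) :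
    |relStream (Metric.ball 0 1) (1 / 4) x - relStream (Metric.ball 0 1) (1 / 4) z| ≤
      21 * √δ := by
  set B := Metric.ball (0 : ℂ) 1
  have hmB : MeasurableSet B := measurableSet_ball
  have hBb : Bornology.IsBounded B := Metric.isBounded_ball
  have hmD := ho.measurableSet
  have hfin : volume (symmDiff B D) ≠ ⊤ := ((hBb.union hb).subset symmDiff_subset_union).measure_lt_top.ne
  have key (E : Set ℂ) (hE : E ⊆ symmDiff B D) :
      |∫ y in E, (Real.log ‖x - y‖ - Real.log ‖z - y‖)| ≤ 4 * (2 * ((2 * Real.pi + 1) * √δ)) := by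
    refine (abs_setIntegral_log_norm_sub_sub_le x z (measure_ne_top_of_subset hE hfin) hδ
      ((measureReal_mono hE hfin).trans hvol)).trans ?_
    gcongr
    linarith [norm_sub_le x z]
  have k1 := key (D \ B) subset_union_right
  have k2 := key (B \ D) subset_union_left
  have ixB := integrableOn_log_norm_sub x hBb hmB
  have izB := integrableOn_log_norm_sub z hBb hmB
  have ixD := integrableOn_log_norm_sub x hb hmD
  have izD := integrableOn_log_norm_sub z hb hmD
  have hsplit := setIntegral_sub_setIntegral_eq hmB hmD (ixB.sub izB) (ixD.sub izD)
  simp only [Pi.sub_apply] at hsplit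
  rw [integral_sub ixB izB, integral_sub ixD izD] at hsplit
  set I1 := ∫ y in D \ B, (Real.log ‖x - y‖ - Real.log ‖z - y‖)
  set I2 := ∫ y in B \ D, (Real.log ‖x - y‖ - Real.log ‖z - y‖)
  have hdiff : relStream B (1 / 4) x - relStream B (1 / 4) z =
      (Ω - 1 / 4) * ((‖x‖ ^ 2 - ‖z‖ ^ 2) / 2) - 1 / (2 * Real.pi) * (I1 - I2) := by
    rw [← hsplit]
    unfold relStream at heq ⊢
    linear_combination heq
  have hsq : δ ≤ √δ := Real.le_sqrt_of_sq_le (by nlinarith)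
  have t1 : |(Ω - 1 / 4) * ((‖x‖ ^ 2 - ‖z‖ ^ 2) / 2)| ≤ √δ * 2 := by
    rw [abs_mul]
    gcongr
    · exact hΩ.trans hsq
    · have := norm_nonneg x
      have := norm_nonneg z
      rw [abs_le]
      constructor <;> nlinarith
  have t2 : |1 / (2 * Real.pi) * (I1 - I2)| ≤ 19 * √δ := by
    rw [abs_mul, abs_of_pos (by positivity), div_mul_eq_mul_div, one_mul,
      div_le_iff₀ (by positivity)]
    refine (abs_sub _ _).trans ((add_le_add k1 k2).trans ?_)
    nlinarith [Real.pi_gt_three, Real.sqrt_nonneg δ]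
  rw [hdiff]
  refine (abs_sub _ _).trans ?_
  linarith

lemma exists_mem_frontier_inter_ball {D : Set ℂ} {c p q : ℂ} {r : ℝ}
    (hp : p ∈ Metric.ball c r) (hpD : p ∈ D) (hq : q ∈ Metric.ball c r) (hqD : q ∉ D) :
    ∃ z ∈ frontier D, z ∈ Metric.ball c r := by
  by_contra! h
  have hsub : Metric.ball c r ⊆ interior D ∪ interior Dᶜ := fun z hz => by
    by_contra hzu
    rw [interior_compl, mem_union, not_or, notMem_compl_iff] at hzu
    exact h z ⟨hzu.2, hzu.1⟩ hz
  have h1 := (convex_ball c r).isPreconnected.subset_left_of_subset_union isOpen_interior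
    isOpen_interior (disjoint_compl_right.mono interior_subset interior_subset) hsub
    ⟨p, hp, (hsub hp).resolve_right fun h' => interior_subset h' hpD⟩
  exact hqD (interior_subset (h1 hq))

lemma pi_mul_sq_le_of_ball_subset {S : Set ℂ} {c : ℂ} {r : ℝ} (hr : 0 ≤ r)
    (h : Metric.ball c r ⊆ S) (hS : volume S ≠ ⊤) : Real.pi * r ^ 2 ≤ volume.real S := by
  refine le_trans (le_of_eq ?_) (measureReal_mono h hS)
  rw [measureReal_def, Complex.volume_ball]
  simp [hr, mul_comm]

theorem boundary_of_weakly_close_vstate_lies_in_thin_annulus :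
    ∃ C δ₀ : ℝ, 0 < C ∧ 0 < δ₀ ∧ ∀ δ : ℝ, 0 < δ → δ ≤ δ₀ →
      ∀ (D : Set ℂ) (Ω : ℝ),
        Bornology.IsBounded D → IsOpen D → SimplyConnectedSpace D →
        IsVState D Ω →
        |Ω - 1 / 4| ≤ δ →
        (volume (symmDiff (Metric.ball (0 : ℂ) 1) D)).toReal ≤ δ →
        ∀ x ∈ frontier D, 1 - C * Real.sqrt δ ≤ ‖x‖ ∧ ‖x‖ ≤ 1 + C * Real.sqrt δ := by
  refine ⟨225, 1 / 10 ^ 8, by norm_num, by norm_num, ?_⟩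
  intro δ hδ hδ0 D Ω hb ho hsc hV hΩ hvol
  obtain ⟨c, hc⟩ := hV
  have hs0 : 0 < √δ := Real.sqrt_pos.2 hδ
  have hs1 : √δ ≤ 1 / 10 ^ 4 := by
    rw [Real.sqrt_le_left (by norm_num)]
    norm_num at hδ0 ⊢
    exact hδ0
  have hsq : √δ ^ 2 = δ := Real.sq_sqrt hδ.le
  have hfin : volume (symmDiff (Metric.ball (0 : ℂ) 1) D) ≠ ⊤ :=
    ((Metric.isBounded_ball.union hb).subset symmDiff_subset_union).measure_lt_top.ne
  have hpi := Real.pi_gt_three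
  -- Balls of large enough area are contained in neither part of the symmetric difference.
  have hlarge (p : ℂ) (r : ℝ) (hr : √δ ≤ r) :
      ¬ Metric.ball p r ⊆ symmDiff (Metric.ball (0 : ℂ) 1) D := fun h => by
    have := pi_mul_sq_le_of_ball_subset (hs0.le.trans hr) h hfin
    have : √δ ^ 2 ≤ r ^ 2 := by gcongr
    have : volume.real (symmDiff (Metric.ball (0 : ℂ) 1) D) ≤ δ := hvol
    nlinarith
  -- A ball outside the unit disk contains a point outside `D`.
  have houter (p : ℂ) (r : ℝ) (hr : √δ ≤ r) (hp : 1 + r ≤ ‖p‖) :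
      ∃ q ∈ Metric.ball p r, q ∉ D := by
    by_contra! h
    refine hlarge p r hr fun q hq => Or.inr ⟨h q hq, fun hq' => ?_⟩
    rw [mem_ball_iff_norm'] at hq
    rw [mem_ball_zero_iff] at hq'
    linarith [norm_sub_norm_le p q]
  obtain ⟨p, hp, hpD⟩ : ∃ p ∈ Metric.ball ((1 - √δ : ℝ) : ℂ) √δ, p ∈ D := by
    by_contra! h
    refine hlarge _ _ le_rfl fun q hq => Or.inl ⟨?_, h q hq⟩
    rw [mem_ball_iff_norm] at hq
    rw [mem_ball_zero_iff]
    have h1 := norm_sub_norm_le q ((1 - √δ : ℝ) : ℂ)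
    rw [Complex.norm_of_nonneg (by linarith)] at h1
    linarith
  obtain ⟨q, hq, hqD⟩ := houter ((1 + √δ : ℝ) : ℂ) √δ le_rfl
    (by rw [Complex.norm_of_nonneg (by linarith)])
  have hnear (t : ℝ) (ht : |t| ≤ √δ) :
      Metric.ball ((1 + t : ℝ) : ℂ) √δ ⊆ Metric.ball (1 : ℂ) (3 * √δ) := by
    refine Metric.ball_subset_ball' ?_
    have : dist ((1 + t : ℝ) : ℂ) 1 = |t| := by
      rw [dist_eq_norm]; simp
    linarith
  obtain ⟨z, hz, hz1⟩ := exists_mem_frontier_inter_ball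
    (hnear (-√δ) (by simp [abs_of_pos hs0]) hp) hpD (hnear √δ (by simp [abs_of_pos hs0]) hq) hqD
  have hz2 : |‖z‖ - 1| ≤ 3 * √δ := by
    rw [mem_ball_iff_norm] at hz1
    have := abs_norm_sub_norm_le z 1
    rw [norm_one] at this
    linarith
  have hz3 : ‖z‖ ≤ 6 / 5 := by linarith [(abs_le.1 hz2).2]
  have hclose (x : ℂ) (hx : x ∈ frontier D) (hx1 : ‖x‖ ≤ 6 / 5) : |‖x‖ - 1| ≤ 225 * √δ := by
    have h1 := abs_relStream_unitBall_sub_le hb ho hδ (by linarith) hΩ hvol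
      (by linarith) (by linarith : ‖z‖ ≤ 2) ((hc x hx).trans (hc z hz).symm)
    have h2 := relStream_unitBall_le_abs_norm_sub_one hz3
    have h3 := abs_norm_sub_one_le_relStream_unitBall hx1
    have h4 := abs_sub_abs_le_abs_sub (relStream (Metric.ball 0 1) (1 / 4) x + 1 / 8)
      (relStream (Metric.ball 0 1) (1 / 4) z + 1 / 8)
    rw [add_sub_add_right_eq_sub] at h4
    linarith
  intro x hx
  suffices hx1 : ‖x‖ ≤ 6 / 5 by
    have := abs_le.1 (hclose x hx hx1)
    constructor <;> linarith
  by_contra! hx1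
  obtain ⟨w, hw, hwD⟩ := mem_closure_iff.1 (frontier_subset_closure hx) {w | 6 / 5 < ‖w‖}
    (isOpen_lt continuous_const continuous_norm) hx1
  have hconn : IsPreconnected D :=
    (isPreconnected_iff_preconnectedSpace).2 inferInstance
  have hp1 : ‖p‖ ≤ 1 := by
    rw [mem_ball_iff_norm] at hp
    have h1 := norm_sub_norm_le p ((1 - √δ : ℝ) : ℂ)
    rw [Complex.norm_of_nonneg (by linarith)] at h1
    linarith
  have hmem : (23 / 20 : ℝ) ∈ Icc ‖p‖ ‖w‖ :=
    ⟨by linarith, by linarith [show 6 / 5 < ‖w‖ from hw]⟩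
  obtain ⟨u, huD, hu : ‖u‖ = 23 / 20⟩ := hconn.intermediate_value hpD hwD
    continuous_norm.continuousOn hmem
  obtain ⟨v, hv, hvD⟩ := houter u (1 / 20) (by linarith) (by linarith)
  obtain ⟨y, hy, hyu⟩ := exists_mem_frontier_inter_ball (Metric.mem_ball_self (by norm_num))
    huD hv hvD
  rw [mem_ball_iff_norm] at hyu
  have hyu' := abs_le.1 (abs_norm_sub_norm_le y u)
  have := (abs_le.1 (hclose y hy (by linarith))).2
  linarith
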